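/- arXiv:2108.02994 — 4 statements merged into one kernel-verified Lean document; each statement's English description precedes it below -/
import Mathlib

section
/- Under the Variant-1 set conditions, the terminal set S := Z₀ × (ℤ ∩ [c−g, b]) is M-step invariant for the overall networked-control-system dynamics under the terminal control policy: for every initial overall state ξ(0) = (x(0), u(0), β(0)) with (x(0), u(0)) ∈ Z₀ and c − g ≤ β(0) ≤ b, the trajectory ξ(j+1) = f(ξ(j), κ_{j}(ξ(j))) obtained by applying κ₀ at step 0 and κ_j (no transmission) at steps j = 1, …, M−1 satisfies: (i) (x(j), u(j)) ∈ 𝕏 × 𝕌 and 0 ≤ β(j) ≤ b for all j = 1, …, M−1 (so all intermediate states lie in Ξ and the token bucket constraint holds), and (ii) ξ(M) ∈ S, i.e., (x(M), u(M)) ∈ Z₀ and c − g ≤ β(M) ≤ b. -/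
open Matrix

/-- Overall state of the networked control system: plant state `x`,
held input `u`, and integer bucket level `β`. -/
abbrev NCSState (n m : ℕ) := (Fin n → ℝ) × (Fin m → ℝ) × ℤ

/-- Overall input: control update `v` and transmission decision `γ ∈ {0,1}`
(modelled as a `Bool`). -/
abbrev NCSInput (n m : ℕ) := (Fin m → ℝ) × Bool

/-- Overall dynamics
`f(ξ, π) = (Ax + Bγv + B(1-γ)u, γv + (1-γ)u, min (β + g - γc) b)`. -/
noncomputable def ncsDyn {n m : ℕ} (A : Matrix (Fin n) (Fin n) ℝ)
    (B : Matrix (Fin n) (Fin m) ℝ) (g c b : ℕ)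
    (ξ : NCSState n m) (π : NCSInput n m) : NCSState n m :=
  ⟨A.mulVec ξ.1 + B.mulVec (if π.2 then π.1 else ξ.2.1),
   if π.2 then π.1 else ξ.2.1,
   min (ξ.2.2 + (g : ℤ) - if π.2 then (c : ℤ) else 0) (b : ℤ)⟩

/-- The stacked vector `z = [x; u] ∈ ℝ^{n+m}`. -/
def vcat {n m : ℕ} (x : Fin n → ℝ) (u : Fin m → ℝ) : Fin n ⊕ Fin m → ℝ :=
  Sum.elim x u

/-- No-transmission step matrix `A₀ = [[A, B], [0, I]]`. -/
noncomputable def A0mat {n m : ℕ} (A : Matrix (Fin n) (Fin n) ℝ)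
    (B : Matrix (Fin n) (Fin m) ℝ) :
    Matrix (Fin n ⊕ Fin m) (Fin n ⊕ Fin m) ℝ :=
  fromBlocks A B 0 1

/-- Transmission step matrix `A₁ = [[A, 0], [0, 0]] + [[B], [I]] K`. -/
noncomputable def A1mat {n m : ℕ} (A : Matrix (Fin n) (Fin n) ℝ)
    (B : Matrix (Fin n) (Fin m) ℝ) (K : Matrix (Fin m) (Fin n ⊕ Fin m) ℝ) :
    Matrix (Fin n ⊕ Fin m) (Fin n ⊕ Fin m) ℝ :=
  fromBlocks A 0 0 0 + fromRows B (1 : Matrix (Fin m) (Fin m) ℝ) * K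

/-- Under the Variant-1 set conditions, the terminal set
`S = Z₀ × (ℤ ∩ [c-g, b])` is `M`-step invariant for the overall NCS dynamics
under the terminal control policy `κ₀(ξ) = (K[x;u], 1)`,
`κ_j(ξ) = (0, 0)` for `j = 1, …, M-1`:  all intermediate states lie in
`Ξ = 𝕏 × 𝕌 × (ℤ ∩ [0, b])`, and the state after `M` steps lies again in `S`. -/
theorem variant1_terminal_set_M_step_invariant {n m : ℕ}
    (A : Matrix (Fin n) (Fin n) ℝ) (B : Matrix (Fin n) (Fin m) ℝ)
    (K : Matrix (Fin m) (Fin n ⊕ Fin m) ℝ)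
    (g c b M : ℕ) (hg : 1 ≤ g) (hgc : g ≤ c) (hcb : c ≤ b)
    (hM : M = ⌈(c : ℚ) / (g : ℚ)⌉₊)
    (𝕏 : Set (Fin n → ℝ)) (𝕌 : Set (Fin m → ℝ))
    (hXc : IsClosed 𝕏) (hUc : IsClosed 𝕌)
    (hX0 : (0 : Fin n → ℝ) ∈ 𝕏) (hU0 : (0 : Fin m → ℝ) ∈ 𝕌)
    (Z₀ : Set (Fin n ⊕ Fin m → ℝ)) (hZc : IsClosed Z₀)
    (hZ0 : (0 : Fin n ⊕ Fin m → ℝ) ∈ Z₀)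
    (hZsub : ∀ z ∈ Z₀, (fun i => z (Sum.inl i)) ∈ 𝕏 ∧ (fun i => z (Sum.inr i)) ∈ 𝕌)
    -- `A₀^j A₁ Z₀ ⊆ 𝕏 × 𝕌` for all `j = 0, …, M-2`
    (hinv1 : ∀ j : ℕ, j + 2 ≤ M → ∀ z ∈ Z₀,
      (fun i => (((A0mat A B) ^ j * A1mat A B K).mulVec z) (Sum.inl i)) ∈ 𝕏 ∧
      (fun i => (((A0mat A B) ^ j * A1mat A B K).mulVec z) (Sum.inr i)) ∈ 𝕌)
    -- `A₀^{M-1} A₁ Z₀ ⊆ Z₀`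
    (hinv2 : ∀ z ∈ Z₀, ((A0mat A B) ^ (M - 1) * A1mat A B K).mulVec z ∈ Z₀)
    -- trajectory under the terminal control policy
    (ξ : ℕ → NCSState n m)
    (hinit : vcat (ξ 0).1 (ξ 0).2.1 ∈ Z₀)
    (hβl : (c : ℤ) - (g : ℤ) ≤ (ξ 0).2.2) (hβu : (ξ 0).2.2 ≤ (b : ℤ))
    (hstep0 : ξ 1 = ncsDyn A B g c b (ξ 0)
      ⟨K.mulVec (vcat (ξ 0).1 (ξ 0).2.1), true⟩)
    (hstep : ∀ j : ℕ, 1 ≤ j → j + 1 ≤ M →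
      ξ (j + 1) = ncsDyn A B g c b (ξ j) ⟨0, false⟩) :
    -- (i) intermediate states lie in `Ξ`
    (∀ j : ℕ, 1 ≤ j → j + 1 ≤ M →
      (ξ j).1 ∈ 𝕏 ∧ (ξ j).2.1 ∈ 𝕌 ∧ 0 ≤ (ξ j).2.2 ∧ (ξ j).2.2 ≤ (b : ℤ)) ∧
    -- (ii) the state after `M` steps lies again in the terminal set `S`
    (vcat (ξ M).1 (ξ M).2.1 ∈ Z₀ ∧
      (c : ℤ) - (g : ℤ) ≤ (ξ M).2.2 ∧ (ξ M).2.2 ≤ (b : ℤ)) := by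
  have hg' : (0 : ℚ) < g := by exact_mod_cast hg
  have hMg : c ≤ M * g := by
    have h1 : (c : ℚ) / g ≤ M := by rw [hM]; exact Nat.le_ceil _
    rw [div_le_iff₀ hg'] at h1
    exact_mod_cast h1
  have hM1 : 1 ≤ M := by
    rcases Nat.eq_zero_or_pos M with h | h
    · subst h; omega
    · exact h
  have key : ∀ k : ℕ, k + 1 ≤ M →
      vcat (ξ (k+1)).1 (ξ (k+1)).2.1
        = ((A0mat A B) ^ k * A1mat A B K).mulVec (vcat (ξ 0).1 (ξ 0).2.1) ∧
      min ((k : ℤ) * g) b ≤ (ξ (k+1)).2.2 ∧ (ξ (k+1)).2.2 ≤ (b : ℤ) := by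
    intro k
    induction k with
    | zero =>
      intro _
      rw [zero_add, hstep0]
      refine ⟨?_, ?_, ?_⟩
      · simp only [ncsDyn, pow_zero, one_mul, A1mat, Matrix.add_mulVec, ← Matrix.mulVec_mulVec]
        simp only [vcat, Matrix.fromBlocks_mulVec, Matrix.fromRows_mulVec]
        ext i
        cases i <;> simp
      · simp only [ncsDyn, if_true, Nat.cast_zero, zero_mul]
        omega
      · simp only [ncsDyn]
        exact min_le_right _ _
    | succ k ih =>
      intro hk
      obtain ⟨h1, h2, h3⟩ := ih (by omega)
      rw [hstep (k+1) (by omega) hk]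
      refine ⟨?_, ?_, ?_⟩
      · rw [pow_succ', Matrix.mul_assoc, ← Matrix.mulVec_mulVec, ← h1]
        simp only [ncsDyn, A0mat, vcat, Matrix.fromBlocks_mulVec]
        ext i
        cases i <;> simp
      · simp only [ncsDyn]
        push_cast
        rw [add_mul, one_mul]
        generalize (k : ℤ) * g = t at *
        omega
      · simp only [ncsDyn]
        exact min_le_right _ _
  refine ⟨?_, ?_⟩
  · intro j hj hjM
    obtain ⟨k, rfl⟩ : ∃ k, j = k + 1 := ⟨j - 1, by omega⟩
    obtain ⟨h1, h2, h3⟩ := key k (by omega)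
    obtain ⟨a1, a2⟩ := hinv1 k (by omega) _ hinit
    rw [← h1] at a1 a2
    refine ⟨a1, a2, le_trans (le_min (by positivity) (by positivity)) h2, h3⟩
  · obtain ⟨k, rfl⟩ : ∃ k, M = k + 1 := ⟨M - 1, by omega⟩
    obtain ⟨h1, h2, h3⟩ := key k le_rfl
    have h4 := hinv2 _ hinit
    rw [Nat.add_sub_cancel, ← h1] at h4
    refine ⟨h4, le_trans (le_min ?_ (by omega)) h2, h3⟩
    have : (c : ℤ) ≤ (k + 1) * g := by exact_mod_cast hMg
    linarith
end

section
/- (Periodic invariance of the Variant-2 terminal sets.) Suppose M ≥ 2 and the Variant-2 set conditions hold. Define S₀ := Z₀ × (ℤ ∩ [c−g, b]) and S_j := Z_j × (ℤ ∩ [(j−1)g, b]) for j = 1, …, M−1. Then the terminal sets are periodically invariant under the terminal control policy: (i) for every ξ ∈ S₀, f(ξ, κ₀(ξ)) ∈ S₁ and the applied transmission respects the token bucket constraint (the updated bucket level is ≥ 0); (ii) for every j ∈ {1, …, M−2} and ξ ∈ S_j, f(ξ, κ_j(ξ)) ∈ S_{j+1}; and (iii) for every ξ ∈ S_{M−1},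 f(ξ, κ_{M−1}(ξ)) ∈ S₀. -/
open Matrix

/-- Periodic invariance of the Variant-2 terminal sets
`S₀ = Z₀ × (ℤ ∩ [c-g, b])` and `S_j = Z_j × (ℤ ∩ [(j-1)g, b])`,
`j = 1, …, M-1`, under the terminal control policy `κ₀(ξ) = (K[x;u], 1)`,
`κ_j(ξ) = (0, 0)`. -/
theorem variant2_terminal_sets_periodically_invariant {n m : ℕ}
    (A : Matrix (Fin n) (Fin n) ℝ) (B : Matrix (Fin n) (Fin m) ℝ)
    (K : Matrix (Fin m) (Fin n ⊕ Fin m) ℝ)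
    (g c b M : ℕ) (hg : 1 ≤ g) (hgc : g ≤ c) (hcb : c ≤ b)
    (hM : M = ⌈(c : ℚ) / (g : ℚ)⌉₊) (hM2 : 2 ≤ M)
    (𝕏 : Set (Fin n → ℝ)) (𝕌 : Set (Fin m → ℝ))
    (hXc : IsClosed 𝕏) (hUc : IsClosed 𝕌)
    (hX0 : (0 : Fin n → ℝ) ∈ 𝕏) (hU0 : (0 : Fin m → ℝ) ∈ 𝕌)
    (Z : ℕ → Set (Fin n ⊕ Fin m → ℝ))
    (hZc : ∀ j : ℕ, j + 1 ≤ M → IsClosed (Z j))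
    (hZ0 : ∀ j : ℕ, j + 1 ≤ M → (0 : Fin n ⊕ Fin m → ℝ) ∈ Z j)
    (hZsub : ∀ j : ℕ, j + 1 ≤ M → ∀ z ∈ Z j,
      (fun i => z (Sum.inl i)) ∈ 𝕏 ∧ (fun i => z (Sum.inr i)) ∈ 𝕌)
    -- Variant-2 set conditions: `A₁ Z₀ ⊆ Z₁`, `A₀ Z_j ⊆ Z_{j+1}` (j = 1, …, M-2),
    -- `A₀ Z_{M-1} ⊆ Z₀`
    (hinv1 : ∀ z ∈ Z 0, (A1mat A B K).mulVec z ∈ Z 1)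
    (hinv2 : ∀ j : ℕ, 1 ≤ j → j + 2 ≤ M → ∀ z ∈ Z j, (A0mat A B).mulVec z ∈ Z (j + 1))
    (hinv3 : ∀ z ∈ Z (M - 1), (A0mat A B).mulVec z ∈ Z 0) :
    -- (i) `f(ξ, κ₀(ξ)) ∈ S₁` for every `ξ ∈ S₀`, and the transmission respects
    -- the token bucket constraint (updated bucket level `≥ 0`)
    (∀ ξ : NCSState n m, vcat ξ.1 ξ.2.1 ∈ Z 0 →
      (c : ℤ) - (g : ℤ) ≤ ξ.2.2 → ξ.2.2 ≤ (b : ℤ) →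
      (vcat (ncsDyn A B g c b ξ ⟨K.mulVec (vcat ξ.1 ξ.2.1), true⟩).1
            (ncsDyn A B g c b ξ ⟨K.mulVec (vcat ξ.1 ξ.2.1), true⟩).2.1 ∈ Z 1 ∧
       ((1 : ℤ) - 1) * g ≤ (ncsDyn A B g c b ξ ⟨K.mulVec (vcat ξ.1 ξ.2.1), true⟩).2.2 ∧
       (ncsDyn A B g c b ξ ⟨K.mulVec (vcat ξ.1 ξ.2.1), true⟩).2.2 ≤ (b : ℤ)) ∧
      0 ≤ (ncsDyn A B g c b ξ ⟨K.mulVec (vcat ξ.1 ξ.2.1), true⟩).2.2) ∧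
    -- (ii) `f(ξ, κ_j(ξ)) ∈ S_{j+1}` for every `j = 1, …, M-2` and `ξ ∈ S_j`
    (∀ j : ℕ, 1 ≤ j → j + 2 ≤ M → ∀ ξ : NCSState n m,
      vcat ξ.1 ξ.2.1 ∈ Z j →
      ((j : ℤ) - 1) * g ≤ ξ.2.2 → ξ.2.2 ≤ (b : ℤ) →
      vcat (ncsDyn A B g c b ξ ⟨0, false⟩).1
           (ncsDyn A B g c b ξ ⟨0, false⟩).2.1 ∈ Z (j + 1) ∧
      (((j : ℤ) + 1) - 1) * g ≤ (ncsDyn A B g c b ξ ⟨0, false⟩).2.2 ∧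
      (ncsDyn A B g c b ξ ⟨0, false⟩).2.2 ≤ (b : ℤ)) ∧
    -- (iii) `f(ξ, κ_{M-1}(ξ)) ∈ S₀` for every `ξ ∈ S_{M-1}`
    (∀ ξ : NCSState n m, vcat ξ.1 ξ.2.1 ∈ Z (M - 1) →
      ((M : ℤ) - 1 - 1) * g ≤ ξ.2.2 → ξ.2.2 ≤ (b : ℤ) →
      vcat (ncsDyn A B g c b ξ ⟨0, false⟩).1
           (ncsDyn A B g c b ξ ⟨0, false⟩).2.1 ∈ Z 0 ∧
      (c : ℤ) - (g : ℤ) ≤ (ncsDyn A B g c b ξ ⟨0, false⟩).2.2 ∧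
      (ncsDyn A B g c b ξ ⟨0, false⟩).2.2 ≤ (b : ℤ)) := by
  have hgq : (0 : ℚ) < (g : ℚ) := by exact_mod_cast hg
  have h1 : c ≤ M * g := by
    have h := Nat.le_ceil ((c : ℚ) / (g : ℚ))
    rw [← hM, div_le_iff₀ hgq] at h
    exact_mod_cast h
  have h2 : M * g < c + g := by
    have h := Nat.ceil_lt_add_one (a := (c : ℚ) / (g : ℚ)) (by positivity)
    rw [← hM] at h
    have h' : (M : ℚ) * g < ((c : ℚ) / g + 1) * g := mul_lt_mul_of_pos_right h hgq
    have h3 : ((c : ℚ) / g + 1) * g = c + g := by field_simp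
    rw [h3] at h'
    exact_mod_cast h'
  zify at h1 h2
  have e0 : ∀ ξ : NCSState n m, vcat (ncsDyn A B g c b ξ ⟨0, false⟩).1
      (ncsDyn A B g c b ξ ⟨0, false⟩).2.1 = (A0mat A B).mulVec (vcat ξ.1 ξ.2.1) := by
    intro ξ
    simp [vcat, ncsDyn, A0mat, fromBlocks_mulVec]
  have e1 : ∀ ξ : NCSState n m,
      vcat (ncsDyn A B g c b ξ ⟨K.mulVec (vcat ξ.1 ξ.2.1), true⟩).1
      (ncsDyn A B g c b ξ ⟨K.mulVec (vcat ξ.1 ξ.2.1), true⟩).2.1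
      = (A1mat A B K).mulVec (vcat ξ.1 ξ.2.1) := by
    intro ξ
    rw [A1mat, add_mulVec, ← mulVec_mulVec, fromRows_mulVec]
    generalize hw : K.mulVec (vcat ξ.1 ξ.2.1) = w
    ext i
    cases i <;> simp [vcat, ncsDyn, fromBlocks_mulVec]
  refine ⟨?_, ?_, ?_⟩
  · intro ξ hz hl hu
    rw [e1]
    refine ⟨⟨hinv1 _ hz, ?_, ?_⟩, ?_⟩ <;> simp [ncsDyn] <;> omega
  · intro j hj hjM ξ hz hl hu
    rw [e0]
    have h3 : ((j : ℤ) + 2) * g ≤ M * g :=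
      mul_le_mul_of_nonneg_right (by exact_mod_cast hjM) (by positivity)
    refine ⟨hinv2 j hj hjM _ hz, ?_, ?_⟩
    · simp only [ncsDyn, Bool.false_eq_true, if_false, le_min_iff]
      constructor <;> nlinarith
    · simp [ncsDyn]
  · intro ξ hz hl hu
    rw [e0]
    refine ⟨hinv3 _ hz, ?_, ?_⟩
    · simp only [ncsDyn, Bool.false_eq_true, if_false, le_min_iff]
      constructor
      · nlinarith
      · omega
    · simp [ncsDyn]
end

section
/- (Recursive feasibility candidate for Variant 1: horizon extension by the terminal policy.) Suppose the Variant-1 set conditions hold for Z₀ and let S := Z₀ × (ℤ ∩ [c−g, b]). Let N ≥ 1 and let ((ξ(i))_{i=0}^{N}, (π(i))_{i=0}^{N−1}) be feasible for the optimal control problem with initial state ξ(0) = ξ, horizon N and terminal set S (i.e., ξ(i+1) = f(ξ(i), π(i)), ξ(i) ∈ Ξ and π(i) ∈ Π for i = 0, …, N−1, and ξ(N) ∈ S). Then the shifted trajectory starting at ξ(1) = f(ξ, π(0)) with inputs (π(1), …, π(N−1)) followed by the M inputs κ₀(ξ(N)), κ₁, …, κ_{M−1} of the terminal control policy applied from ξ(N)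 is feasible for the optimal control problem with initial state ξ(1), horizon N − 1 + M and terminal set S. -/
open Matrix

/-- The trajectory of the overall system generated from initial state `ξ0`
by the input sequence `πs`. -/
noncomputable def ncsTraj {n m : ℕ} (A : Matrix (Fin n) (Fin n) ℝ)
    (B : Matrix (Fin n) (Fin m) ℝ) (g c b : ℕ)
    (ξ0 : NCSState n m) (πs : ℕ → NCSInput n m) : ℕ → NCSState n m
  | 0 => ξ0
  | k + 1 => ncsDyn A B g c b (ncsTraj A B g c b ξ0 πs k) (πs k)

/-- Stage cost `ℓ(ξ, π) = xᵀQx + (1-γ)uᵀRu + γvᵀRv`. -/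
noncomputable def stageCost {n m : ℕ} (Q : Matrix (Fin n) (Fin n) ℝ)
    (R : Matrix (Fin m) (Fin m) ℝ) (ξ : NCSState n m) (π : NCSInput n m) : ℝ :=
  ξ.1 ⬝ᵥ Q.mulVec ξ.1 +
    (if π.2 then π.1 ⬝ᵥ R.mulVec π.1 else ξ.2.1 ⬝ᵥ R.mulVec ξ.2.1)

/-- Feasibility for the constrained OCP: state constraints
`ξ(i) ∈ Ξ = 𝕏 × 𝕌 × (ℤ ∩ [0, b])` and input constraints
`π(i) ∈ Π = 𝕌 × {0,1}` for `i = 0, …, N-1`, and terminal constraint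
`ξ(N) ∈ Ξf`. -/
noncomputable def FeasOCP {n m : ℕ} (A : Matrix (Fin n) (Fin n) ℝ)
    (B : Matrix (Fin n) (Fin m) ℝ) (g c b : ℕ)
    (𝕏 : Set (Fin n → ℝ)) (𝕌 : Set (Fin m → ℝ))
    (ξ0 : NCSState n m) (N : ℕ) (Ξf : Set (NCSState n m))
    (πs : ℕ → NCSInput n m) : Prop :=
  (∀ i < N, (ncsTraj A B g c b ξ0 πs i).1 ∈ 𝕏 ∧
      (ncsTraj A B g c b ξ0 πs i).2.1 ∈ 𝕌 ∧
      0 ≤ (ncsTraj A B g c b ξ0 πs i).2.2 ∧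
      (ncsTraj A B g c b ξ0 πs i).2.2 ≤ (b : ℤ) ∧
      (πs i).1 ∈ 𝕌) ∧
  ncsTraj A B g c b ξ0 πs N ∈ Ξf

theorem aux_A0 {n m : ℕ} (A : Matrix (Fin n) (Fin n) ℝ) (B : Matrix (Fin n) (Fin m) ℝ)
    (g c b : ℕ) (ξ : NCSState n m) (v : Fin m → ℝ) :
    vcat (ncsDyn A B g c b ξ (v, false)).1 (ncsDyn A B g c b ξ (v, false)).2.1
      = (A0mat A B).mulVec (vcat ξ.1 ξ.2.1) := by
  simp [vcat, ncsDyn, A0mat, fromBlocks_mulVec]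

theorem aux_A1 {n m : ℕ} (A : Matrix (Fin n) (Fin n) ℝ) (B : Matrix (Fin n) (Fin m) ℝ)
    (K : Matrix (Fin m) (Fin n ⊕ Fin m) ℝ)
    (g c b : ℕ) (ξ : NCSState n m) :
    vcat (ncsDyn A B g c b ξ (K.mulVec (vcat ξ.1 ξ.2.1), true)).1
      (ncsDyn A B g c b ξ (K.mulVec (vcat ξ.1 ξ.2.1), true)).2.1
      = (A1mat A B K).mulVec (vcat ξ.1 ξ.2.1) := by
  rw [A1mat, add_mulVec, ← mulVec_mulVec]
  simp only [vcat, ncsDyn, fromBlocks_mulVec, fromRows_mulVec]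
  ext i
  cases i <;> simp

/-- Recursive feasibility candidate for Variant 1: if
`(ξ(i))_{i≤N}, (π(i))_{i<N}` is feasible for the OCP with initial state `ξ0`,
horizon `N` and terminal set `S = Z₀ × (ℤ ∩ [c-g, b])`, then the shifted
input sequence, extended by the `M` inputs of the terminal control policy
applied from `ξ(N)`, is feasible for the OCP with initial state
`ξ(1) = f(ξ0, π(0))`, horizon `N - 1 + M` and the same terminal set. -/
theorem variant1_recursive_feasibility_candidate {n m : ℕ}
    (A : Matrix (Fin n) (Fin n) ℝ) (B : Matrix (Fin n) (Fin m) ℝ)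
    (K : Matrix (Fin m) (Fin n ⊕ Fin m) ℝ)
    (g c b M : ℕ) (hg : 1 ≤ g) (hgc : g ≤ c) (hcb : c ≤ b)
    (hM : M = ⌈(c : ℚ) / (g : ℚ)⌉₊)
    (𝕏 : Set (Fin n → ℝ)) (𝕌 : Set (Fin m → ℝ))
    (hXc : IsClosed 𝕏) (hUc : IsClosed 𝕌)
    (hX0 : (0 : Fin n → ℝ) ∈ 𝕏) (hU0 : (0 : Fin m → ℝ) ∈ 𝕌)
    (Z₀ : Set (Fin n ⊕ Fin m → ℝ)) (hZc : IsClosed Z₀)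
    (hZ0 : (0 : Fin n ⊕ Fin m → ℝ) ∈ Z₀)
    (hZsub : ∀ z ∈ Z₀, (fun i => z (Sum.inl i)) ∈ 𝕏 ∧ (fun i => z (Sum.inr i)) ∈ 𝕌)
    (hinv1 : ∀ j : ℕ, j + 2 ≤ M → ∀ z ∈ Z₀,
      (fun i => (((A0mat A B) ^ j * A1mat A B K).mulVec z) (Sum.inl i)) ∈ 𝕏 ∧
      (fun i => (((A0mat A B) ^ j * A1mat A B K).mulVec z) (Sum.inr i)) ∈ 𝕌)
    (hinv2 : ∀ z ∈ Z₀, ((A0mat A B) ^ (M - 1) * A1mat A B K).mulVec z ∈ Z₀)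
    -- `K` maps `Z₀` into `𝕌`, so the transmitted input is admissible
    (hK : ∀ z ∈ Z₀, K.mulVec z ∈ 𝕌)
    (N : ℕ) (hN : 1 ≤ N)
    (ξ0 : NCSState n m) (πs : ℕ → NCSInput n m)
    (hfeas : FeasOCP A B g c b 𝕏 𝕌 ξ0 N
      {ξ : NCSState n m | vcat ξ.1 ξ.2.1 ∈ Z₀ ∧
        (c : ℤ) - (g : ℤ) ≤ ξ.2.2 ∧ ξ.2.2 ≤ (b : ℤ)} πs) :
    FeasOCP A B g c b 𝕏 𝕌 (ncsDyn A B g c b ξ0 (πs 0)) (N - 1 + M)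
      {ξ : NCSState n m | vcat ξ.1 ξ.2.1 ∈ Z₀ ∧
        (c : ℤ) - (g : ℤ) ≤ ξ.2.2 ∧ ξ.2.2 ≤ (b : ℤ)}
      (fun i =>
        if i + 1 < N then πs (i + 1)
        else if i + 1 = N then
          ⟨K.mulVec (vcat (ncsTraj A B g c b ξ0 πs N).1
              (ncsTraj A B g c b ξ0 πs N).2.1), true⟩
        else ⟨0, false⟩) := by
  obtain ⟨h1, hz, hb1, hb2⟩ := hfeas
  have hg' : (0 : ℚ) < g := by exact_mod_cast hg
  have hMg : c ≤ M * g := by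
    have h : (c : ℚ) / g ≤ M := by rw [hM]; exact Nat.le_ceil _
    rw [div_le_iff₀ hg'] at h
    exact_mod_cast h
  have hM1 : 1 ≤ M := by
    rcases Nat.eq_zero_or_pos M with h | h
    · subst h; omega
    · exact h
  clear hM
  set ξN := ncsTraj A B g c b ξ0 πs N with hξN
  set ps : ℕ → NCSInput n m := (fun i =>
        if i + 1 < N then πs (i + 1)
        else if i + 1 = N then
          ⟨K.mulVec (vcat ξN.1 ξN.2.1), true⟩
        else ⟨0, false⟩) with hps
  set T := ncsTraj A B g c b (ncsDyn A B g c b ξ0 (πs 0)) ps with hT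
  have hshift : ∀ i, i + 1 ≤ N → T i = ncsTraj A B g c b ξ0 πs (i + 1) := by
    intro i
    induction i with
    | zero => intro _; rfl
    | succ k ih =>
      intro h
      have hp : ps k = πs (k + 1) := by
        simp only [hps]; rw [if_pos (by omega)]
      change ncsDyn A B g c b (T k) (ps k) = ncsDyn A B g c b _ (πs (k + 1))
      rw [ih (by omega), hp]
  have hTN : T (N - 1) = ξN := by
    rw [hshift _ (by omega), Nat.sub_add_cancel hN]
  have hpN : ps (N - 1) = (K.mulVec (vcat ξN.1 ξN.2.1), true) := by
    simp only [hps]; rw [if_neg (by omega), if_pos (by omega)]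
  have htail : ∀ j, vcat (T (N + j)).1 (T (N + j)).2.1
        = ((A0mat A B) ^ j * A1mat A B K).mulVec (vcat ξN.1 ξN.2.1) ∧
      min ((j * g : ℕ) : ℤ) b ≤ (T (N + j)).2.2 ∧ (T (N + j)).2.2 ≤ b := by
    intro j
    induction j with
    | zero =>
      have e : T (N + 0) = ncsDyn A B g c b ξN (K.mulVec (vcat ξN.1 ξN.2.1), true) := by
        have : N + 0 = (N - 1) + 1 := by omega
        rw [this]
        change ncsDyn A B g c b (T (N - 1)) (ps (N - 1)) = _
        rw [hTN, hpN]
      rw [e, aux_A1]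
      refine ⟨by simp, ?_, ?_⟩
      · simp only [ncsDyn, if_true]; push_cast; omega
      · simp only [ncsDyn]; exact min_le_right _ _
    | succ k ih =>
      obtain ⟨i1, i2, i3⟩ := ih
      have e : T (N + (k + 1)) = ncsDyn A B g c b (T (N + k)) (0, false) := by
        change ncsDyn A B g c b (T (N + k)) (ps (N + k)) = _
        congr 1
        simp only [hps]; rw [if_neg (by omega), if_neg (by omega)]
      rw [e, aux_A0, i1]
      refine ⟨by rw [mulVec_mulVec, pow_succ', Matrix.mul_assoc], ?_, ?_⟩
      · have : ((k + 1) * g : ℕ) = k * g + g := by ring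
        rw [this]
        simp only [ncsDyn]
        generalize k * g = q at *
        simp only [Bool.false_eq_true, if_false]
        push_cast
        omega
      · simp only [ncsDyn]; exact min_le_right _ _
  refine ⟨?_, ?_⟩
  · intro i hi
    rcases lt_trichotomy (i + 1) N with h | h | h
    · obtain ⟨a1, a2, a3, a4, a5⟩ := h1 (i + 1) h
      have hp : ps i = πs (i + 1) := by
        simp only [hps]; rw [if_pos h]
      change (T i).1 ∈ 𝕏 ∧ (T i).2.1 ∈ 𝕌 ∧ 0 ≤ (T i).2.2 ∧ (T i).2.2 ≤ (b : ℤ) ∧ (ps i).1 ∈ 𝕌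
      rw [hshift i h.le, hp]
      exact ⟨a1, a2, a3, a4, a5⟩
    · have : i = N - 1 := by omega
      subst this
      change (T (N - 1)).1 ∈ 𝕏 ∧ (T (N - 1)).2.1 ∈ 𝕌 ∧ 0 ≤ (T (N - 1)).2.2 ∧
        (T (N - 1)).2.2 ≤ (b : ℤ) ∧ (ps (N - 1)).1 ∈ 𝕌
      rw [hTN, hpN]
      exact ⟨(hZsub _ hz).1, (hZsub _ hz).2, by omega, hb2, hK _ hz⟩
    · obtain ⟨j, rfl⟩ : ∃ j, i = N + j := ⟨i - N, by omega⟩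
      change (T (N + j)).1 ∈ 𝕏 ∧ (T (N + j)).2.1 ∈ 𝕌 ∧ 0 ≤ (T (N + j)).2.2 ∧
        (T (N + j)).2.2 ≤ (b : ℤ) ∧ (ps (N + j)).1 ∈ 𝕌
      obtain ⟨i1, i2, i3⟩ := htail j
      have hp : ps (N + j) = (0, false) := by
        simp only [hps]; rw [if_neg (by omega), if_neg (by omega)]
      have h2 := hinv1 j (by omega) _ hz
      rw [← i1] at h2
      rw [hp]
      exact ⟨h2.1, h2.2, le_trans (le_min (by positivity) (by positivity)) i2, i3, hU0⟩
  · change vcat (T (N - 1 + M)).1 (T (N - 1 + M)).2.1 ∈ Z₀ ∧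
        (c : ℤ) - (g : ℤ) ≤ (T (N - 1 + M)).2.2 ∧ (T (N - 1 + M)).2.2 ≤ (b : ℤ)
    have e : N - 1 + M = N + (M - 1) := by omega
    rw [e]
    obtain ⟨i1, i2, i3⟩ := htail (M - 1)
    refine ⟨by rw [i1]; exact hinv2 _ hz, ?_, i3⟩
    have : (M - 1) * g + g = M * g := by
      obtain ⟨k, rfl⟩ : ∃ k, M = k + 1 := ⟨M - 1, by omega⟩
      simp; ring
    generalize (M - 1) * g = q at *
    generalize M * g = r at *
    omega
end

section
/- (Recursive feasibility candidate for Variant 2: one-step shift with periodic terminal sets.) Suppose M ≥ 2 and the Variant-2 set conditions hold, define S₀ := Z₀ × (ℤ ∩ [c−g, b]) and S_j := Z_j × (ℤ ∩ [(j−1)g, b]) for j = 1, …, M−1, and fix j ∈ {0, …, M−1}. Let N̄ ≥ 1 and let ((ξ(i))_{i=0}^{N̄}, (π(i))_{i=0}^{N̄−1}) be feasible for the optimal control problem with initial state ξ, horizon N̄ and terminal set S_j (i.e., ξ(0) = ξ, ξ(i+1) = f(ξ(i), π(i)), ξ(i) ∈ Ξ and π(i) ∈ Π for i = 0, …, N̄−1,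 and ξ(N̄) ∈ S_j). Then the shifted trajectory starting at ξ(1) = f(ξ, π(0)) with inputs (π(1), …, π(N̄−1)) followed by the single input κ_j(ξ(N̄)) of the terminal control policy is feasible for the optimal control problem with initial state ξ(1), horizon N̄ and terminal set S_{(j+1) mod M}. -/
open Matrix

/-- The Variant-2 terminal sets: `S₀ = Z₀ × (ℤ ∩ [c-g, b])` and
`S_j = Z_j × (ℤ ∩ [(j-1)g, b])` for `j = 1, …, M-1`. -/
def termSet {n m : ℕ} (g c b : ℕ) (Z : ℕ → Set (Fin n ⊕ Fin m → ℝ)) (j : ℕ) :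
    Set (NCSState n m) :=
  if j = 0 then
    {ξ : NCSState n m | vcat ξ.1 ξ.2.1 ∈ Z 0 ∧
      (c : ℤ) - (g : ℤ) ≤ ξ.2.2 ∧ ξ.2.2 ≤ (b : ℤ)}
  else
    {ξ : NCSState n m | vcat ξ.1 ξ.2.1 ∈ Z j ∧
      ((j : ℤ) - 1) * (g : ℤ) ≤ ξ.2.2 ∧ ξ.2.2 ≤ (b : ℤ)}

/-- Recursive feasibility candidate for Variant 2: if
`(ξ(i))_{i≤Nb}, (π(i))_{i<Nb}` is feasible for the OCP with initial state
`ξ0`, horizon `Nb` and terminal set `S_j`, then the shifted input sequence,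
extended by the single input `κ_j(ξ(Nb))` of the terminal control policy, is
feasible for the OCP with initial state `ξ(1) = f(ξ0, π(0))`, horizon `Nb`
and terminal set `S_{(j+1) mod M}`. -/
theorem variant2_recursive_feasibility_candidate {n m : ℕ}
    (A : Matrix (Fin n) (Fin n) ℝ) (B : Matrix (Fin n) (Fin m) ℝ)
    (K : Matrix (Fin m) (Fin n ⊕ Fin m) ℝ)
    (g c b M : ℕ) (hg : 1 ≤ g) (hgc : g ≤ c) (hcb : c ≤ b)
    (hM : M = ⌈(c : ℚ) / (g : ℚ)⌉₊) (hM2 : 2 ≤ M)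
    (𝕏 : Set (Fin n → ℝ)) (𝕌 : Set (Fin m → ℝ))
    (hXc : IsClosed 𝕏) (hUc : IsClosed 𝕌)
    (hX0 : (0 : Fin n → ℝ) ∈ 𝕏) (hU0 : (0 : Fin m → ℝ) ∈ 𝕌)
    (Z : ℕ → Set (Fin n ⊕ Fin m → ℝ))
    (hZc : ∀ j : ℕ, j + 1 ≤ M → IsClosed (Z j))
    (hZ0 : ∀ j : ℕ, j + 1 ≤ M → (0 : Fin n ⊕ Fin m → ℝ) ∈ Z j)
    (hZsub : ∀ j : ℕ, j + 1 ≤ M → ∀ z ∈ Z j,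
      (fun i => z (Sum.inl i)) ∈ 𝕏 ∧ (fun i => z (Sum.inr i)) ∈ 𝕌)
    (hinv1 : ∀ z ∈ Z 0, (A1mat A B K).mulVec z ∈ Z 1)
    (hinv2 : ∀ j : ℕ, 1 ≤ j → j + 2 ≤ M → ∀ z ∈ Z j,
      (A0mat A B).mulVec z ∈ Z (j + 1))
    (hinv3 : ∀ z ∈ Z (M - 1), (A0mat A B).mulVec z ∈ Z 0)
    -- `K` maps `Z₀` into `𝕌`, so the transmitted input is admissible
    (hK : ∀ z ∈ Z 0, K.mulVec z ∈ 𝕌)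
    (j : ℕ) (hj : j + 1 ≤ M)
    (Nb : ℕ) (hNb : 1 ≤ Nb)
    (ξ0 : NCSState n m) (πs : ℕ → NCSInput n m)
    (hfeas : FeasOCP A B g c b 𝕏 𝕌 ξ0 Nb (termSet g c b Z j) πs) :
    FeasOCP A B g c b 𝕏 𝕌 (ncsDyn A B g c b ξ0 (πs 0)) Nb
      (termSet g c b Z ((j + 1) % M))
      (fun i =>
        if i + 1 < Nb then πs (i + 1)
        else if j = 0 then
          ⟨K.mulVec (vcat (ncsTraj A B g c b ξ0 πs Nb).1
              (ncsTraj A B g c b ξ0 πs Nb).2.1), true⟩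
        else ⟨0, false⟩) := by
  obtain ⟨hst, hterm⟩ := hfeas
  set ξN := ncsTraj A B g c b ξ0 πs Nb with hξN
  set ρ : ℕ → NCSInput n m := (fun i =>
        if i + 1 < Nb then πs (i + 1)
        else if j = 0 then
          ⟨K.mulVec (vcat ξN.1 ξN.2.1), true⟩
        else ⟨0, false⟩) with hρ
  have htraj : ∀ i, i + 1 ≤ Nb →
      ncsTraj A B g c b (ncsDyn A B g c b ξ0 (πs 0)) ρ i = ncsTraj A B g c b ξ0 πs (i + 1) := by
    intro i
    induction i with
    | zero => intro _; rfl
    | succ k ih =>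
      intro hk
      have h1 : ρ k = πs (k + 1) := by
        simp only [hρ]
        rw [if_pos (by omega)]
      change ncsDyn A B g c b (ncsTraj A B g c b _ ρ k) (ρ k) = _
      rw [ih (by omega), h1]
      rfl
  have hgpos : (0 : ℚ) < g := by exact_mod_cast hg
  have hMc : c ≤ M * g := by
    have h : (c : ℚ) / g ≤ M := by rw [hM]; exact Nat.le_ceil _
    rw [div_le_iff₀ hgpos] at h
    exact_mod_cast h
  have hMc' : (M - 1) * g < c := by
    have h : M - 1 < ⌈(c : ℚ) / (g : ℚ)⌉₊ := by omega
    rw [Nat.lt_ceil, lt_div_iff₀ hgpos] at h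
    exact_mod_cast h
  have hZj : vcat ξN.1 ξN.2.1 ∈ Z j := by
    unfold termSet at hterm
    split_ifs at hterm with h0
    · rw [h0]; exact hterm.1
    · exact hterm.1
  have hβ : 0 ≤ ξN.2.2 ∧ ξN.2.2 ≤ b := by
    unfold termSet at hterm
    split_ifs at hterm with h0
    · exact ⟨by have := hterm.2.1; omega, hterm.2.2⟩
    · refine ⟨le_trans (mul_nonneg (by omega) (by omega)) hterm.2.1, hterm.2.2⟩
  have hNlast : ρ (Nb - 1) = if j = 0 then
          (⟨K.mulVec (vcat ξN.1 ξN.2.1), true⟩ : NCSInput n m)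
        else ⟨0, false⟩ := by
    simp only [hρ]
    rw [if_neg (by omega)]
  have hstep0 : A0mat A B *ᵥ vcat ξN.1 ξN.2.1 = vcat (A *ᵥ ξN.1 + B *ᵥ ξN.2.1) ξN.2.1 := by
    simp [A0mat, vcat, fromBlocks_mulVec]
  have hstep1 : A1mat A B K *ᵥ vcat ξN.1 ξN.2.1 =
      vcat (A *ᵥ ξN.1 + B *ᵥ (K *ᵥ vcat ξN.1 ξN.2.1)) (K *ᵥ vcat ξN.1 ξN.2.1) := by
    have h1 : fromBlocks A 0 0 0 *ᵥ vcat ξN.1 ξN.2.1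
        = Sum.elim (A *ᵥ ξN.1) (0 : Fin m → ℝ) := by
      simp [vcat, fromBlocks_mulVec]
    rw [A1mat, add_mulVec, h1, ← mulVec_mulVec, fromRows_mulVec]
    funext i
    cases i <;> simp [vcat]
  have hfin : ncsTraj A B g c b (ncsDyn A B g c b ξ0 (πs 0)) ρ Nb
      = ncsDyn A B g c b ξN (ρ (Nb - 1)) := by
    obtain ⟨k, rfl⟩ : ∃ k, Nb = k + 1 := ⟨Nb - 1, by omega⟩
    change ncsDyn A B g c b (ncsTraj A B g c b _ ρ k) (ρ k) = _
    rw [htraj k le_rfl]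
    rfl
  refine ⟨?_, ?_⟩
  · intro i hi
    rw [htraj i hi]
    by_cases hlt : i + 1 < Nb
    · have h1 : ρ i = πs (i + 1) := by
        simp only [hρ]
        rw [if_pos hlt]
      rw [h1]
      exact hst (i + 1) hlt
    · have hi' : i + 1 = Nb := by omega
      have hi2 : i = Nb - 1 := by omega
      rw [hi', hi2, hNlast, ← hξN]
      obtain ⟨hx, hu⟩ := hZsub j hj _ hZj
      refine ⟨hx, hu, hβ.1, hβ.2, ?_⟩
      split_ifs with h0
      · subst h0; exact hK _ hZj
      · exact hU0
  · rw [hfin, hNlast]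
    by_cases h0 : j = 0
    · subst h0
      rw [Nat.mod_eq_of_lt (by omega)]
      have := hinv1 _ hZj
      rw [hstep1] at this
      simp only [termSet, if_true, Set.mem_setOf_eq] at hterm
      simp only [termSet, ncsDyn, if_true, Set.mem_setOf_eq]
      refine ⟨this, ?_, min_le_right _ _⟩
      simp
      omega
    · simp only [termSet, if_neg h0, Set.mem_setOf_eq] at hterm
      by_cases hl : j + 1 = M
      · rw [hl, Nat.mod_self]
        have hjM : j = M - 1 := by omega
        have := hinv3 _ (hjM ▸ hZj)
        rw [hstep0] at this
        simp only [termSet, ncsDyn, if_neg h0, if_true, Set.mem_setOf_eq]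
        refine ⟨by simpa using this, ?_, min_le_right _ _⟩
        have h2 := hterm.2.1
        have h3 : (c : ℤ) ≤ ((j : ℤ) + 1) * g := by
          rw [← hl] at hMc; exact_mod_cast hMc
        simp
        constructor <;> nlinarith
      · rw [Nat.mod_eq_of_lt (by omega)]
        have := hinv2 j (by omega) (by omega) _ hZj
        rw [hstep0] at this
        simp only [termSet, ncsDyn, if_neg h0, if_neg (Nat.succ_ne_zero j), Set.mem_setOf_eq]
        refine ⟨by simpa using this, ?_, min_le_right _ _⟩
        have h2 := hterm.2.1
        have h4 : j * g ≤ (M - 1) * g := Nat.mul_le_mul_right _ (by omega)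
        have h3 : (j : ℤ) * g ≤ b := by
          have : j * g ≤ b := by omega
          exact_mod_cast this
        simp
        exact ⟨by linarith, h3⟩
end
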